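/- Let n ≥ 0 and let (u_j(t))_{j≥1} be a solution of the Sabra shell model whose forcing has a maximum wavenumber k_max (i.e. f_j = 0 for j > j_max, k_max = k_0 λ^{j_max}) and satisfies Φ_n < ∞. Then K_n = H_n + τ² Φ_n, with τ = ν^{−1} k_0^{−2}, satisfies both (1/2) dK_n/dt ≤ −ν K_{n+1} + c_n K_n sup_j (k_j |u_j|) + ν (k_0² + k_max²) K_n and (1/2) dK_n/dt ≤ −(ν/2) K_{n+1} + (d_n/ν) K_n sup_j |u_j|² + ν (k_0² + k_max²) K_n, where c_n = λ^{−n+1}(|a|λ^{−2n} + |b| + |a+b|λ^{2n}) and d_n = c_n²/(2λ⁴). -/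

import Mathlib

open Filter MeasureTheory
open scoped BigOperators Topology

noncomputable section

/-- Logarithmically spaced wavenumbers `k_j = k₀ λ^j`. -/
def wk (k₀ lam : ℝ) (j : ℕ) : ℝ := k₀ * lam ^ j

/-- Sabra forcing `f_j = F φ_{j - j_f}` (with the convention `φ_p = 0` for `p < 0`). -/
def sabraForcing (F : ℂ) (φ : ℕ → ℂ) (jf j : ℕ) : ℂ :=
  if jf ≤ j then F * φ (j - jf) else 0

/-- Right-hand side of the Sabra shell model
`i(a k_{j+1} u*_{j+1} u_{j+2} + b k_j u_{j+1} u*_{j-1} - c k_{j-1} u_{j-1} u_{j-2}) - ν k_j² u_j + f_j`. -/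
def sabraRHS (a b c ν k₀ lam : ℝ) (f : ℕ → ℂ) (v : ℕ → ℂ) (j : ℕ) : ℂ :=
  Complex.I * (((a * wk k₀ lam (j+1) : ℝ) : ℂ) * (starRingEnd ℂ) (v (j+1)) * v (j+2)
      + ((b * wk k₀ lam j : ℝ) : ℂ) * v (j+1) * (starRingEnd ℂ) (v (j-1))
      - ((c * wk k₀ lam (j-1) : ℝ) : ℂ) * v (j-1) * v (j-2))
    - ((ν * (wk k₀ lam j)^2 : ℝ) : ℂ) * v j + f j

/-- `u` is a solution of the Sabra shell model on the time set `s`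
(the boundary conditions `u_0 = u_{-1} = 0` are encoded by `u 0 t = 0` together with
truncated subtraction on the indices). -/
def IsSabraSolution (a b c ν k₀ lam : ℝ) (f : ℕ → ℂ) (u : ℕ → ℝ → ℂ) (s : Set ℝ) : Prop :=
  (∀ t : ℝ, u 0 t = 0) ∧
  ∀ j : ℕ, 1 ≤ j → ∀ t ∈ s,
    HasDerivAt (fun τ => u j τ) (sabraRHS a b c ν k₀ lam f (fun i => u i t) j) t

/-- Energy `E(t) = Σ_{j≥1} |u_j(t)|²`. -/
def sEnergy (u : ℕ → ℝ → ℂ) (t : ℝ) : ℝ := ∑' j : ℕ, ‖u (j+1) t‖^2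

/-- `H_n = Σ_{j≥1} k_j^{2n} |v_j|²`. -/
def HnS (k₀ lam : ℝ) (n : ℕ) (v : ℕ → ℂ) : ℝ :=
  ∑' j : ℕ, (wk k₀ lam (j+1))^(2*n) * ‖v (j+1)‖^2

/-- `H_{n,m} = Σ_{j≥1} k_j^{2nm} |v_j|^{2m}`. -/
def HnmS (k₀ lam : ℝ) (n m : ℕ) (v : ℕ → ℂ) : ℝ :=
  ∑' j : ℕ, (wk k₀ lam (j+1))^(2*n*m) * ‖v (j+1)‖^(2*m)

/-- `Φ_n = Σ_{j≥1} k_j^{2n} |f_j|²`. -/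
def PhinS (k₀ lam : ℝ) (n : ℕ) (f : ℕ → ℂ) : ℝ :=
  ∑' j : ℕ, (wk k₀ lam (j+1))^(2*n) * ‖f (j+1)‖^2

/-- Time average `⟨g⟩ = T⁻¹ ∫_0^T g dt`. -/
def timeAvg (T : ℝ) (g : ℝ → ℝ) : ℝ := T⁻¹ * ∫ t in (0:ℝ)..T, g t

/-- `C_γ = Σ_{p≥0} λ^{2γp} |φ_p|²`. -/
def CgS (lam γ : ℝ) (φ : ℕ → ℂ) : ℝ := ∑' p : ℕ, lam ^ (2*γ*(p:ℝ)) * ‖φ p‖^2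

/-- `B_γ = sup_{p≥0} λ^{-(2γ-1)p} |φ_p|`. -/
def BgS (lam γ : ℝ) (φ : ℕ → ℂ) : ℝ := ⨆ p : ℕ, lam ^ (-(2*γ-1)*(p:ℝ)) * ‖φ p‖

/-- `A = |a|λ + |b| + |a+b|λ⁻¹`. -/
def AconstS (a b lam : ℝ) : ℝ := |a| * lam + |b| + |a + b| * lam⁻¹

/-- `c_n = λ^{-n+1}(|a|λ^{-2n} + |b| + |a+b|λ^{2n})`. -/
def cnS (a b lam : ℝ) (n : ℕ) : ℝ :=
  lam ^ (1 - (n:ℤ)) * (|a| * lam ^ (-(2*(n:ℤ))) + |b| + |a + b| * lam ^ (2*(n:ℤ)))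

/-- `d_n = c_n²/(2λ⁴)`. -/
def dnS (a b lam : ℝ) (n : ℕ) : ℝ := (cnS a b lam n)^2 / (2 * lam^4)

/-- `U = ⟨E⟩^{1/2}` over `[0,T]`. -/
def Uavg (u : ℕ → ℝ → ℂ) (T : ℝ) : ℝ := Real.sqrt (timeAvg T (sEnergy u))

/-- Reynolds number `Re = U/(ν k_f)` over `[0,T]`. -/
def ReynoldsNum (u : ℕ → ℝ → ℂ) (T ν kf : ℝ) : ℝ := Uavg u T / (ν * kf)

/-- Time-averaged energy-dissipation rate `ε = ν ⟨Σ_j k_j² |u_j|²⟩` over `[0,T]`. -/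
def epsAvg (k₀ lam ν : ℝ) (u : ℕ → ℝ → ℂ) (T : ℝ) : ℝ :=
  ν * timeAvg T (fun t => HnS k₀ lam 1 (fun j => u j t))


theorem duhamel_aux (g N : ℝ → ℂ) (μ B G s0 s1 : ℝ) (hμ : 0 < μ) (hB : 0 ≤ B)
    (hg : ∀ s, HasDerivAt g (-(μ:ℂ) * g s + N s) s)
    (hN : ∀ s ∈ Set.Icc s0 s1, ‖N s‖ ≤ B) (h0 : ‖g s0‖ ≤ G) :
    ∀ s ∈ Set.Icc s0 s1, ‖g s‖ ≤ Real.exp (-(μ * (s - s0))) * G + B / μ := by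
  have hE : ∀ s : ℝ, HasDerivAt (fun s : ℝ => Real.exp (μ * (s - s0)))
      (Real.exp (μ * (s - s0)) * μ) s := by
    intro s
    have h1 : HasDerivAt (fun s : ℝ => μ * (s - s0)) μ s := by
      simpa using ((hasDerivAt_id s).sub_const s0).const_mul μ
    exact h1.exp
  have hw : ∀ s, HasDerivAt (fun s : ℝ => ((Real.exp (μ * (s - s0)) : ℝ) : ℂ) * g s)
      (((Real.exp (μ * (s - s0)) : ℝ) : ℂ) * N s) s := by
    intro s
    have h1 := ((hE s).ofReal_comp).mul (hg s)
    have e : ((Real.exp (μ * (s - s0)) : ℝ) : ℂ) * N s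
        = ((Real.exp (μ * (s - s0)) * μ : ℝ) : ℂ) * g s
          + ((Real.exp (μ * (s - s0)) : ℝ) : ℂ) * (-(μ:ℂ) * g s + N s) := by
      push_cast
      ring
    rw [e]
    exact h1
  have key := image_norm_le_of_norm_deriv_right_le_deriv_boundary
    (a := s0) (b := s1)
    (f := fun s : ℝ => ((Real.exp (μ * (s - s0)) : ℝ) : ℂ) * g s)
    (f' := fun s : ℝ => ((Real.exp (μ * (s - s0)) : ℝ) : ℂ) * N s)
    (B := fun s => G + (B / μ) * (Real.exp (μ * (s - s0)) - 1))
    (B' := fun s => (B / μ) * (Real.exp (μ * (s - s0)) * μ))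
    (fun s _ => (hw s).continuousAt.continuousWithinAt)
    (fun s _ => (hw s).hasDerivWithinAt)
    (by simpa using h0)
    (fun s => by
      have := (((hE s).sub_const 1).const_mul (B/μ)).const_add G
      exact this)
    (fun s hs => by
      have h1 := hN s ⟨hs.1, hs.2.le⟩
      have h2 : 0 < Real.exp (μ * (s - s0)) := Real.exp_pos _
      rw [norm_mul, Complex.norm_real, Real.norm_of_nonneg h2.le]
      have : (B / μ) * (Real.exp (μ * (s - s0)) * μ) = Real.exp (μ * (s - s0)) * B := by
        field_simp
      rw [this]
      gcongr)
  intro s hs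
  have h := key hs
  have h2 : 0 < Real.exp (μ * (s - s0)) := Real.exp_pos _
  simp only [norm_mul, Complex.norm_real, Real.norm_of_nonneg h2.le] at h
  rw [Real.exp_neg]
  set e := Real.exp (μ * (s - s0)) with he
  have hq : 0 ≤ B / μ := by positivity
  have h3 : e * ‖g s‖ ≤ e * (e⁻¹ * G + B / μ) := by
    have : e * (e⁻¹ * G + B / μ) = G + e * (B/μ) := by field_simp
    rw [this]; nlinarith
  exact le_of_mul_le_mul_left h3 h2

/-- nonlinear plus forcing part -/
def sNL (a b c k₀ lam : ℝ) (f : ℕ → ℂ) (v : ℕ → ℂ) (j : ℕ) : ℂ :=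
  Complex.I * (((a * wk k₀ lam (j+1) : ℝ) : ℂ) * (starRingEnd ℂ) (v (j+1)) * v (j+2)
      + ((b * wk k₀ lam j : ℝ) : ℂ) * v (j+1) * (starRingEnd ℂ) (v (j-1))
      - ((c * wk k₀ lam (j-1) : ℝ) : ℂ) * v (j-1) * v (j-2)) + f j

theorem rhs_eq (a b c ν k₀ lam : ℝ) (f v : ℕ → ℂ) (j : ℕ) :
    sabraRHS a b c ν k₀ lam f v j
      = -((ν * (wk k₀ lam j)^2 : ℝ) : ℂ) * v j + sNL a b c k₀ lam f v j := by
  unfold sabraRHS sNL; ring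

theorem wk_pos' {k₀ lam : ℝ} (hk₀ : 0 < k₀) (hlam : 1 < lam) (j : ℕ) : 0 < wk k₀ lam j := by
  unfold wk; have : 0 < lam := by linarith
  positivity

theorem sNL_norm {k₀ lam : ℝ} (hk₀ : 0 < k₀) (hlam : 1 < lam) (a b c : ℝ) (f v : ℕ → ℂ) (j : ℕ) :
    ‖sNL a b c k₀ lam f v j‖ ≤ |a| * wk k₀ lam (j+1) * ‖v (j+1)‖ * ‖v (j+2)‖
      + |b| * wk k₀ lam j * ‖v (j+1)‖ * ‖v (j-1)‖
      + |c| * wk k₀ lam (j-1) * ‖v (j-1)‖ * ‖v (j-2)‖ + ‖f j‖ := by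
  have hw := fun i => (wk_pos' hk₀ hlam i).le
  unfold sNL
  refine (norm_add_le _ _).trans ?_
  gcongr
  rw [norm_mul, Complex.norm_I, one_mul]
  refine (norm_sub_le _ _).trans ?_
  refine add_le_add ((norm_add_le _ _).trans (add_le_add ?_ ?_)) ?_ <;>
  · simp only [norm_mul, Complex.norm_real, Real.norm_eq_abs, RCLike.norm_conj,
      abs_of_nonneg (hw _)]
    exact le_rfl

/-- uniform decay at a rate `p` on a neighbourhood of `t` -/
def DecayAt (lam : ℝ) (u : ℕ → ℝ → ℂ) (t : ℝ) (p : ℕ) : Prop :=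
  ∃ C δ : ℝ, 0 ≤ C ∧ 0 < δ ∧ ∀ s ∈ Set.Icc (t - δ) (t + δ), ∀ j : ℕ,
    ‖u j s‖ * lam ^ (j * p) ≤ C

theorem sNL_decay {k₀ lam : ℝ} (hk₀ : 0 < k₀) (hlam : 1 < lam) (a b c : ℝ) (f : ℕ → ℂ)
    (jmax : ℕ) (hcut : ∀ j : ℕ, jmax < j → f j = 0) (p : ℕ) (C : ℝ) (hC : 0 ≤ C) :
    ∃ B : ℝ, 0 ≤ B ∧ ∀ v : ℕ → ℂ, (∀ j, ‖v j‖ * lam ^ (j * p) ≤ C) →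
      ∀ j, 1 ≤ j → ‖sNL a b c k₀ lam f v j‖ * lam ^ (j * p) ≤ B * lam ^ j := by
  have hl0 : 0 < lam := by linarith
  set F : ℝ := ∑ i ∈ Finset.range (jmax + 1), ‖f i‖ * lam ^ (i * p) with hF
  have hF0 : 0 ≤ F := Finset.sum_nonneg fun i _ => by positivity
  have hFj : ∀ j, ‖f j‖ * lam ^ (j * p) ≤ F := by
    intro j
    by_cases h : jmax < j
    · rw [hcut j h]; simpa using hF0
    · exact Finset.single_le_sum (f := fun i => ‖f i‖ * lam ^ (i * p))
        (fun i _ => by positivity) (Finset.mem_range.2 (by omega))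
  refine ⟨|a| * k₀ * lam * C * C + |b| * k₀ * C * C + |c| * k₀ * lam ^ p * C * C + F,
    by positivity, ?_⟩
  intro v hv j hj
  have hvC : ∀ i, ‖v i‖ ≤ C := fun i =>
    (le_mul_of_one_le_right (norm_nonneg _) (one_le_pow₀ hlam.le)).trans (hv i)
  have h1 : ‖v (j+1)‖ * lam ^ (j * p) ≤ C := by
    refine le_trans ?_ (hv (j+1))
    gcongr
    · exact hlam.le
    · omega
  obtain ⟨m, rfl⟩ : ∃ m, j = m + 1 := ⟨j - 1, by omega⟩
  have h2 : ‖v m‖ * lam ^ ((m+1) * p) ≤ lam ^ p * C := by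
    have := hv m
    calc ‖v m‖ * lam ^ ((m+1) * p) = lam ^ p * (‖v m‖ * lam ^ (m * p)) := by ring
      _ ≤ _ := by gcongr
  have h0 := sNL_norm hk₀ hlam a b c f v (m+1)
  have hL : 1 ≤ lam ^ (m+1) := one_le_pow₀ hlam.le
  have hLm : lam ^ m ≤ lam ^ (m+1) := pow_le_pow_right₀ hlam.le (by omega)
  simp only [Nat.add_sub_cancel, wk] at h0
  set Q := lam ^ ((m+1) * p) with hQ
  have hQ0 : 0 < Q := by positivity
  have e1 := hvC (m+1+2)
  have e2 := hvC m
  have e3 := hvC (m+1-2)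
  calc ‖sNL a b c k₀ lam f v (m+1)‖ * Q
      ≤ (|a| * (k₀ * lam ^ (m + 1 + 1)) * ‖v (m + 1 + 1)‖ * ‖v (m + 1 + 2)‖ +
        |b| * (k₀ * lam ^ (m + 1)) * ‖v (m + 1 + 1)‖ * ‖v m‖ +
        |c| * (k₀ * lam ^ m) * ‖v m‖ * ‖v (m + 1 - 2)‖ + ‖f (m + 1)‖) * Q := by gcongr
    _ = |a| * k₀ * lam * (‖v (m + 1 + 1)‖ * Q) * ‖v (m + 1 + 2)‖ * lam ^ (m+1) +
        |b| * k₀ * (‖v (m + 1 + 1)‖ * Q) * ‖v m‖ * lam ^ (m + 1) +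
        |c| * k₀ * (‖v m‖ * Q) * ‖v (m + 1 - 2)‖ * lam ^ m + ‖f (m + 1)‖ * Q := by ring
    _ ≤ |a| * k₀ * lam * C * C * lam ^ (m+1) +
        |b| * k₀ * C * C * lam ^ (m + 1) +
        |c| * k₀ * (lam ^ p * C) * C * lam ^ (m+1) + F * lam ^ (m+1) := by
      have h5 : ‖f (m+1)‖ * Q ≤ F * lam ^ (m+1) :=
        (hFj (m+1)).trans (le_mul_of_one_le_right hF0 hL)
      gcongr
    _ = _ := by ring

theorem decay_step (a b c ν k₀ lam : ℝ)
    (hν : 0 < ν) (hk₀ : 0 < k₀) (hlam : 1 < lam) (f : ℕ → ℂ) (jmax : ℕ)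
    (hcut : ∀ j : ℕ, jmax < j → f j = 0) (u : ℕ → ℝ → ℂ)
    (hsol : IsSabraSolution a b c ν k₀ lam f u Set.univ) (t : ℝ) (p : ℕ)
    (h : DecayAt lam u t p) : DecayAt lam u t (p+1) := by
  obtain ⟨C, δ, hC, hδ, hb⟩ := h
  have hl0 : 0 < lam := by linarith
  obtain ⟨B, hB, hNL⟩ := sNL_decay hk₀ hlam a b c f jmax hcut p C hC
  refine ⟨(2 * C / δ + B) / (ν * k₀^2), δ/2, by positivity, by positivity, ?_⟩
  intro s hs j
  rcases Nat.eq_zero_or_pos j with rfl | hj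
  · rw [hsol.1 s]; simp; positivity
  set μ := ν * (wk k₀ lam j)^2 with hμ
  have hμ0 : 0 < μ := by have := wk_pos' hk₀ hlam j; positivity
  set Q := lam ^ (j * p) with hQ
  have hQ0 : 0 < Q := by positivity
  have hd := duhamel_aux (u j) (fun s => sNL a b c k₀ lam f (fun i => u i s) j) μ
    (B * lam ^ j / Q) (C / Q) (t - δ) (t + δ) hμ0 (by positivity)
    (fun s => by
      have := hsol.2 j hj s (Set.mem_univ _)
      rwa [rhs_eq] at this)
    (fun s hs => by
      rw [le_div_iff₀ hQ0]
      exact hNL (fun i => u i s) (hb s hs) j hj)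
    (by rw [le_div_iff₀ hQ0]
        exact hb (t - δ) ⟨le_rfl, by linarith⟩ j)
    s ⟨by linarith [hs.1], by linarith [hs.2]⟩
  have hexp : Real.exp (-(μ * (s - (t - δ)))) ≤ 2 / (μ * δ) := by
    rw [Real.exp_neg, inv_le_comm₀ (Real.exp_pos _) (by positivity), inv_div]
    have h1 := Real.add_one_le_exp (μ * (s - (t - δ)))
    have h2 : μ * δ / 2 ≤ μ * (s - (t - δ)) := by
      have : δ / 2 ≤ s - (t - δ) := by linarith [hs.1]
      nlinarith
    linarith
  have hL : 1 ≤ lam ^ j := one_le_pow₀ hlam.le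
  have hL0 : 0 < lam ^ j := by positivity
  have hμe : μ = ν * k₀^2 * (lam ^ j)^2 := by rw [hμ, wk]; ring
  calc ‖u j s‖ * lam ^ (j * (p+1)) = ‖u j s‖ * (Q * lam ^ j) := by rw [hQ]; ring
    _ ≤ (2 / (μ * δ) * (C / Q) + B * lam ^ j / Q / μ) * (Q * lam ^ j) := by
      have : 0 ≤ C / Q := by positivity
      gcongr
      exact hd.trans (by gcongr)
    _ = (2 * C / δ / lam ^ j + B) / (ν * k₀^2) := by
      rw [hμe]; field_simp
    _ ≤ _ := by
      have : 2 * C / δ / lam ^ j ≤ 2 * C / δ := div_le_self (by positivity) hL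
      gcongr

theorem decay_all (a b c ν k₀ lam : ℝ)
    (hν : 0 < ν) (hk₀ : 0 < k₀) (hlam : 1 < lam) (f : ℕ → ℂ) (jmax : ℕ)
    (hcut : ∀ j : ℕ, jmax < j → f j = 0) (u : ℕ → ℝ → ℂ)
    (hsol : IsSabraSolution a b c ν k₀ lam f u Set.univ) (t : ℝ)
    (h : DecayAt lam u t 0) (p : ℕ) : DecayAt lam u t p := by
  induction p with
  | zero => exact h
  | succ p ih => exact decay_step a b c ν k₀ lam hν hk₀ hlam f jmax hcut u hsol t p ih

theorem term_deriv (a b c ν k₀ lam : ℝ)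
    (hν : 0 < ν) (hk₀ : 0 < k₀) (hlam : 1 < lam) (f : ℕ → ℂ) (jmax : ℕ)
    (hcut : ∀ j : ℕ, jmax < j → f j = 0) (u : ℕ → ℝ → ℂ)
    (hsol : IsSabraSolution a b c ν k₀ lam f u Set.univ) (t : ℝ) (n : ℕ)
    (h : DecayAt lam u t (2*n+2)) :
    Summable (fun j : ℕ => (wk k₀ lam (j+1))^(2*n) *
      (2 * inner ℝ (u (j+1) t) (sabraRHS a b c ν k₀ lam f (fun i => u i t) (j+1)))) ∧
    HasDerivAt (fun s => HnS k₀ lam n (fun j => u j s))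
      (∑' j : ℕ, (wk k₀ lam (j+1))^(2*n) *
      (2 * inner ℝ (u (j+1) t) (sabraRHS a b c ν k₀ lam f (fun i => u i t) (j+1)))) t := by
  obtain ⟨C, δ, hC, hδ, hb⟩ := h
  have hl0 : 0 < lam := by linarith
  obtain ⟨B, hB, hNL⟩ := sNL_decay hk₀ hlam a b c f jmax hcut (2*n+2) C hC
  have hgeo : Summable (fun j : ℕ => (k₀^(2*n) * 2 * C * (ν * k₀^2 * C + B)) * (lam⁻¹)^(j+1)) :=
    ((summable_nat_add_iff 1).2
      (summable_geometric_of_lt_one (by positivity) (inv_lt_one_of_one_lt₀ hlam))).mul_left _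
  have hbound : ∀ (j : ℕ) (s : ℝ), s ∈ Set.Ioo (t-δ) (t+δ) →
      ‖(wk k₀ lam (j+1))^(2*n) *
      (2 * inner ℝ (u (j+1) s) (sabraRHS a b c ν k₀ lam f (fun i => u i s) (j+1)))‖
      ≤ (k₀^(2*n) * 2 * C * (ν * k₀^2 * C + B)) * (lam⁻¹)^(j+1) := by
    intro j s hs
    have hs' := Set.Ioo_subset_Icc_self hs
    have h1 := hb s hs' (j+1)
    have h2 := hNL (fun i => u i s) (hb s hs') (j+1) (by omega)
    have hi := norm_inner_le_norm (𝕜 := ℝ) (u (j+1) s)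
      (sabraRHS a b c ν k₀ lam f (fun i => u i s) (j+1))
    have hw := wk_pos' hk₀ hlam (j+1)
    set L := lam ^ (j+1) with hL
    have hL0 : 0 < L := by positivity
    have hL1 : 1 ≤ L := one_le_pow₀ hlam.le
    have hQ : lam ^ ((j+1) * (2*n+2)) = L^(2*n) * L^2 := by rw [hL]; ring
    rw [hQ] at h1 h2
    have hwL : wk k₀ lam (j+1) = k₀ * L := rfl
    have h3 : ‖u (j+1) s‖ ≤ C / (L^(2*n) * L^2) := by rwa [le_div_iff₀ (by positivity)]
    have hp1 : 1 ≤ L^(2*n) := one_le_pow₀ hL1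
    have h4 : ‖sabraRHS a b c ν k₀ lam f (fun i => u i s) (j+1)‖ ≤ ν * k₀^2 * C + B := by
      rw [rhs_eq]
      refine (norm_add_le _ _).trans (add_le_add ?_ ?_)
      · rw [norm_mul, norm_neg, Complex.norm_real, Real.norm_of_nonneg (by positivity), hwL]
        calc ν * (k₀ * L)^2 * ‖u (j+1) s‖ ≤ ν * (k₀ * L)^2 * (C / (L^(2*n) * L^2)) := by gcongr
          _ = ν * k₀^2 * C / L^(2*n) := by field_simp
          _ ≤ _ := div_le_self (by positivity) hp1
      · have : ‖sNL a b c k₀ lam f (fun i => u i s) (j+1)‖ ≤ B * L / (L^(2*n) * L^2) := by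
          rwa [le_div_iff₀ (by positivity)]
        refine this.trans ?_
        rw [div_le_iff₀ (by positivity)]
        have : L ≤ L^(2*n) * L^2 := by nlinarith
        gcongr
    rw [norm_mul, norm_mul, Real.norm_of_nonneg (by positivity : 0 ≤ wk k₀ lam (j+1)^(2*n)), hwL,
      Real.norm_of_nonneg (by norm_num : (0:ℝ) ≤ 2)]
    calc (k₀ * L)^(2*n) * (2 * ‖inner ℝ (u (j+1) s) (sabraRHS a b c ν k₀ lam f (fun i => u i s) (j+1))‖)
        ≤ (k₀ * L)^(2*n) * (2 * ((C / (L^(2*n) * L^2)) * (ν * k₀^2 * C + B))) := by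
          gcongr
          exact hi.trans (by gcongr)
      _ = (k₀^(2*n) * 2 * C * (ν * k₀^2 * C + B)) * (L⁻¹)^2 := by
          rw [mul_pow]; field_simp
      _ ≤ (k₀^(2*n) * 2 * C * (ν * k₀^2 * C + B)) * (lam⁻¹)^(j+1) := by
          rw [inv_pow lam, ← hL]
          gcongr
          have : L⁻¹ ≤ 1 := inv_le_one_of_one_le₀ hL1
          have : 0 < L⁻¹ := by positivity
          nlinarith
  have ht : t ∈ Set.Ioo (t-δ) (t+δ) := ⟨by linarith, by linarith⟩
  refine ⟨Summable.of_norm_bounded hgeo (fun j => hbound j t ht), ?_⟩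
  unfold HnS
  refine hasDerivAt_tsum_of_isPreconnected (t := Set.Ioo (t-δ) (t+δ)) (y₀ := t) hgeo isOpen_Ioo
    isPreconnected_Ioo (g := fun (j : ℕ) s => (wk k₀ lam (j+1))^(2*n) * ‖u (j+1) s‖^2)
    (g' := fun (j : ℕ) s => (wk k₀ lam (j+1))^(2*n) *
      (2 * inner ℝ (u (j+1) s) (sabraRHS a b c ν k₀ lam f (fun i => u i s) (j+1))))
    ?_ hbound ht ?_ ht
  · intro j s _
    exact ((hsol.2 (j+1) (by omega) s (Set.mem_univ _)).norm_sq).const_mul _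
  · refine Summable.of_nonneg_of_le (fun j => by have := wk_pos' hk₀ hlam (j+1); positivity)
      (fun j => ?_) (((summable_nat_add_iff 1).2
      (summable_geometric_of_lt_one (by positivity : 0 ≤ lam⁻¹) (inv_lt_one_of_one_lt₀ hlam))).mul_left
        (k₀^(2*n) * C * C))
    have h1 := hb t (Set.Ioo_subset_Icc_self ht) (j+1)
    set L := lam ^ (j+1) with hL
    have hL0 : 0 < L := by positivity
    have hL1 : 1 ≤ L := one_le_pow₀ hlam.le
    have hQ : lam ^ ((j+1) * (2*n+2)) = L^(2*n) * L^2 := by rw [hL]; ring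
    rw [hQ] at h1
    have hp1 : 1 ≤ L^(2*n) := one_le_pow₀ hL1
    have h3 : ‖u (j+1) t‖ ≤ C / (L^(2*n) * L^2) := by rwa [le_div_iff₀ (by positivity)]
    have h4 : ‖u (j+1) t‖ ≤ C := h3.trans (div_le_self hC (by nlinarith))
    have hwL : wk k₀ lam (j+1) = k₀ * L := rfl
    rw [hwL]
    calc (k₀ * L)^(2*n) * ‖u (j+1) t‖^2 = (k₀ * L)^(2*n) * (‖u (j+1) t‖ * ‖u (j+1) t‖) := by ring
      _ ≤ (k₀ * L)^(2*n) * ((C / (L^(2*n) * L^2)) * C) := by gcongr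
      _ = (k₀^(2*n) * C * C) * (L⁻¹)^2 := by rw [mul_pow]; field_simp
      _ ≤ _ := by
          rw [inv_pow lam, ← hL]
          gcongr
          have : L⁻¹ ≤ 1 := inv_le_one_of_one_le₀ hL1
          have : 0 < L⁻¹ := by positivity
          nlinarith

theorem summable_H_of_decay {k₀ lam : ℝ} (hk₀ : 0 < k₀) (hlam : 1 < lam) (v : ℕ → ℂ) (m : ℕ) (C : ℝ)
    (hv : ∀ j, ‖v j‖ * lam ^ (j * (m+1)) ≤ C) :
    Summable (fun j : ℕ => (wk k₀ lam (j+1))^(2*m) * ‖v (j+1)‖^2) := by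
  have hl0 : 0 < lam := by linarith
  refine Summable.of_nonneg_of_le (fun j => by have := wk_pos' hk₀ hlam (j+1); positivity)
    (fun j => ?_) (((summable_nat_add_iff 1).2
    (summable_geometric_of_lt_one (by positivity : 0 ≤ lam⁻¹) (inv_lt_one_of_one_lt₀ hlam))).mul_left
      (k₀^(2*m) * C ^ 2))
  have h1 := hv (j+1)
  set L := lam ^ (j+1) with hL
  have hL0 : 0 < L := by positivity
  have hL1 : 1 ≤ L := one_le_pow₀ hlam.le
  have hQ : lam ^ ((j+1) * (m+1)) = L^m * L := by rw [hL]; ring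
  rw [hQ] at h1
  have hwL : wk k₀ lam (j+1) = k₀ * L := rfl
  rw [hwL]
  have h3 : ‖v (j+1)‖ ≤ C / (L^m * L) := by rwa [le_div_iff₀ (by positivity)]
  calc (k₀ * L)^(2*m) * ‖v (j+1)‖^2 ≤ (k₀ * L)^(2*m) * (C / (L^m * L))^2 := by gcongr
    _ = (k₀^(2*m) * C ^ 2) * (L⁻¹)^2 := by rw [mul_pow]; field_simp; ring
    _ ≤ _ := by
        rw [inv_pow lam, ← hL]
        gcongr
        have : L⁻¹ ≤ 1 := inv_le_one_of_one_le₀ hL1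
        have : 0 < L⁻¹ := by positivity
        nlinarith

theorem tail_le (g : ℕ → ℝ) (hg : Summable g) (h0 : ∀ i, 0 ≤ g i) (k : ℕ) :
    ∑' i, g (i + k) ≤ ∑' i, g i := by
  rw [← hg.sum_add_tsum_nat_add k]
  have : 0 ≤ ∑ i ∈ Finset.range k, g i := Finset.sum_nonneg fun i _ => h0 i
  linarith

theorem inner_bound {ν k₀ lam : ℝ} (hk₀ : 0 < k₀) (hlam : 1 < lam) (a b c : ℝ) (f v : ℕ → ℂ) (j : ℕ) :
    inner ℝ (v j) (sabraRHS a b c ν k₀ lam f v j) ≤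
      -(ν * (wk k₀ lam j)^2) * ‖v j‖^2 + ‖v j‖ * (|a| * wk k₀ lam (j+1) * ‖v (j+1)‖ * ‖v (j+2)‖
      + |b| * wk k₀ lam j * ‖v (j+1)‖ * ‖v (j-1)‖
      + |c| * wk k₀ lam (j-1) * ‖v (j-1)‖ * ‖v (j-2)‖ + ‖f j‖) := by
  rw [rhs_eq, ← Complex.ofReal_neg, ← Complex.real_smul, inner_add_right, real_inner_smul_right,
    real_inner_self_eq_norm_sq]
  have h1 := real_inner_le_norm (v j) (sNL a b c k₀ lam f v j)
  have h2 := mul_le_mul_of_nonneg_left (sNL_norm hk₀ hlam a b c f v j) (norm_nonneg (v j))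
  linarith

/-- the triple products -/
def Zt (k₀ lam : ℝ) (n : ℕ) (v : ℕ → ℂ) (i : ℕ) : ℝ :=
  (wk k₀ lam i)^(2*n+1) * (‖v (i-1)‖ * ‖v i‖ * ‖v (i+1)‖)

/-- coefficient -/
def Acoef (a b lam : ℝ) (n : ℕ) : ℝ := |a| * (lam ^ (2*n))⁻¹ + |b| + |a + b| * lam ^ (2*n)

theorem cnS_eq {lam : ℝ} (hlam : 1 < lam) (a b : ℝ) (n : ℕ) :
    cnS a b lam n = lam / lam ^ n * Acoef a b lam n := by
  have hl0 : lam ≠ 0 := by linarith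
  unfold cnS Acoef
  rw [zpow_sub₀ hl0, zpow_one, zpow_natCast, zpow_neg]
  have : lam ^ (2 * (n:ℤ)) = lam ^ (2*n) := by
    rw [← zpow_natCast]; push_cast; rfl
  rw [this]

theorem term_le {ν k₀ lam : ℝ} (hν : 0 < ν) (hk₀ : 0 < k₀) (hlam : 1 < lam) (a b c : ℝ)
    (habc : a + b + c = 0) (n : ℕ) (f v : ℕ → ℂ) (hv0 : v 0 = 0) (i : ℕ) :
    (wk k₀ lam (i+1))^(2*n) * inner ℝ (v (i+1)) (sabraRHS a b c ν k₀ lam f v (i+1)) ≤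
      |a| * (lam ^ (2*n))⁻¹ * Zt k₀ lam n v (i+2) + |b| * Zt k₀ lam n v (i+1)
      + |a + b| * lam ^ (2*n) * Zt k₀ lam n v i
      - ν * ((wk k₀ lam (i+1))^(2*(n+1)) * ‖v (i+1)‖^2)
      + ν * k₀^2 * ((wk k₀ lam (i+1))^(2*n) * ‖v (i+1)‖^2
        + ((ν * k₀^2)⁻¹)^2 * ((wk k₀ lam (i+1))^(2*n) * ‖f (i+1)‖^2)) := by
  have hl0 : 0 < lam := by linarith
  have hc : |c| = |a + b| := by rw [← abs_neg]; congr 1; linarith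
  have h1 := inner_bound (ν := ν) hk₀ hlam a b c f v (i+1)
  have hw := wk_pos' hk₀ hlam (i+1)
  have h2 := mul_le_mul_of_nonneg_left h1 (by positivity : 0 ≤ (wk k₀ lam (i+1))^(2*n))
  refine h2.trans ?_
  have e1 : wk k₀ lam (i+2) = lam * wk k₀ lam (i+1) := by unfold wk; ring
  have T3 : (wk k₀ lam (i+1))^(2*n) * (‖v (i+1)‖ * (|c| * wk k₀ lam i * ‖v i‖ * ‖v (i+1-2)‖))
      = |a + b| * lam ^ (2*n) * Zt k₀ lam n v i := by
    rw [hc]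
    cases i with
    | zero => simp [hv0, Zt]
    | succ m =>
      have e2 : wk k₀ lam (m+1+1) = lam * wk k₀ lam (m+1) := by unfold wk; ring
      have e3 : m + 1 + 1 - 2 = m := by omega
      simp only [Zt, e2, e3, Nat.add_sub_cancel]
      ring
  have T1 : (wk k₀ lam (i+1))^(2*n) * (‖v (i+1)‖ * (|a| * wk k₀ lam (i+1+1) * ‖v (i+1+1)‖ * ‖v (i+1+2)‖))
      = |a| * (lam ^ (2*n))⁻¹ * Zt k₀ lam n v (i+2) := by
    have e3 : i + 2 - 1 = i + 1 := by omega
    simp only [Zt, e3]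
    rw [show i + 1 + 1 = i + 2 from rfl, show i + 1 + 2 = i + 2 + 1 from rfl, e1, pow_succ, mul_pow]
    field_simp
  have T2 : (wk k₀ lam (i+1))^(2*n) * (‖v (i+1)‖ * (|b| * wk k₀ lam (i+1) * ‖v (i+1+1)‖ * ‖v i‖))
      = |b| * Zt k₀ lam n v (i+1) := by
    simp only [Zt, Nat.add_sub_cancel]
    ring
  have T4 : ‖v (i+1)‖ * ‖f (i+1)‖ ≤ ν * k₀^2 * (‖v (i+1)‖^2 + ((ν * k₀^2)⁻¹)^2 * ‖f (i+1)‖^2) := by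
    have hg : 0 < ν * k₀^2 := by positivity
    have hgi : 0 < (ν * k₀^2)⁻¹ := by positivity
    have e : ‖v (i+1)‖ * ‖f (i+1)‖ = (ν * k₀^2) * (‖v (i+1)‖ * ((ν * k₀^2)⁻¹ * ‖f (i+1)‖)) := by
      field_simp
    rw [e, ← mul_pow]
    refine mul_le_mul_of_nonneg_left ?_ hg.le
    nlinarith [sq_nonneg (‖v (i+1)‖ - (ν * k₀^2)⁻¹ * ‖f (i+1)‖),
      sq_nonneg (‖v (i+1)‖), sq_nonneg ((ν * k₀^2)⁻¹ * ‖f (i+1)‖)]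
  have T4' := mul_le_mul_of_nonneg_left T4 (by positivity : 0 ≤ (wk k₀ lam (i+1))^(2*n))
  have e5 : (wk k₀ lam (i+1))^(2*(n+1)) = (wk k₀ lam (i+1))^(2*n) * (wk k₀ lam (i+1))^2 := by ring
  rw [← T1, ← T2, ← T3, e5]
  simp only [Nat.add_sub_cancel]
  linarith

theorem sum_le {ν k₀ lam : ℝ} (hν : 0 < ν) (hk₀ : 0 < k₀) (hlam : 1 < lam) (a b c : ℝ)
    (habc : a + b + c = 0) (n : ℕ) (f v : ℕ → ℂ) (hv0 : v 0 = 0)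
    (hT : Summable (fun i => (wk k₀ lam (i+1))^(2*n) *
      inner ℝ (v (i+1)) (sabraRHS a b c ν k₀ lam f v (i+1))))
    (hZ : Summable (fun i => Zt k₀ lam n v (i+2)))
    (hH : Summable (fun j : ℕ => (wk k₀ lam (j+1))^(2*n) * ‖v (j+1)‖^2))
    (hH1 : Summable (fun j : ℕ => (wk k₀ lam (j+1))^(2*(n+1)) * ‖v (j+1)‖^2))
    (hΦ : Summable (fun j : ℕ => (wk k₀ lam (j+1))^(2*n) * ‖f (j+1)‖^2)) :
    ∑' i, (wk k₀ lam (i+1))^(2*n) * inner ℝ (v (i+1)) (sabraRHS a b c ν k₀ lam f v (i+1))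
      ≤ Acoef a b lam n * (∑' i, Zt k₀ lam n v (i+2)) - ν * HnS k₀ lam (n+1) v
        + ν * k₀^2 * (HnS k₀ lam n v + ((ν * k₀^2)⁻¹)^2 * PhinS k₀ lam n f) := by
  have h0 : Summable (Zt k₀ lam n v) := (summable_nat_add_iff 2).1 hZ
  have h1 : Summable (fun i => Zt k₀ lam n v (i+1)) := (summable_nat_add_iff 1).2 h0
  have z0 : Zt k₀ lam n v 0 = 0 := by simp [Zt, hv0]
  have z1 : Zt k₀ lam n v 1 = 0 := by simp [Zt, hv0]
  have s0 : ∑' i, Zt k₀ lam n v i = ∑' i, Zt k₀ lam n v (i+2) := by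
    rw [← h0.sum_add_tsum_nat_add 2]; simp [Finset.sum_range_succ, z0, z1]
  have s1 : ∑' i, Zt k₀ lam n v (i+1) = ∑' i, Zt k₀ lam n v (i+2) := by
    rw [← s0, ← h0.sum_add_tsum_nat_add 1]; simp [z0]
  have q0 := h0.hasSum
  have q1 := h1.hasSum
  have q2 := hZ.hasSum
  rw [s0] at q0
  rw [s1] at q1
  have R := ((((q2.mul_left (|a| * (lam ^ (2*n))⁻¹)).add (q1.mul_left |b|)).add
    (q0.mul_left (|a + b| * lam ^ (2*n)))).sub (hH1.hasSum.mul_left ν)).add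
    ((hH.hasSum.add (hΦ.hasSum.mul_left (((ν * k₀^2)⁻¹)^2))).mul_left (ν * k₀^2))
  have := hasSum_le (fun i => term_le hν hk₀ hlam a b c habc n f v hv0 i) hT.hasSum R
  refine this.trans (le_of_eq ?_)
  unfold Acoef HnS PhinS
  ring

theorem Z_bound1 {k₀ lam : ℝ} (hk₀ : 0 < k₀) (hlam : 1 < lam) (n : ℕ) (v : ℕ → ℂ) (S : ℝ)
    (hS : ∀ j, wk k₀ lam (j+1) * ‖v (j+1)‖ ≤ S)
    (hH : Summable (fun j : ℕ => (wk k₀ lam (j+1))^(2*n) * ‖v (j+1)‖^2)) :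
    Summable (fun i => Zt k₀ lam n v (i+2)) ∧
      ∑' i, Zt k₀ lam n v (i+2) ≤ lam / lam ^ n * S * HnS k₀ lam n v := by
  have hl0 : 0 < lam := by linarith
  have hw := fun i => wk_pos' hk₀ hlam i
  have hS0 : 0 ≤ S := le_trans (by have := hw (0+1); positivity) (hS 0)
  set h : ℕ → ℝ := fun j : ℕ => (wk k₀ lam (j+1))^(2*n) * ‖v (j+1)‖^2 with hh
  have hn : ∀ i, 0 ≤ h i := fun i => by have := hw (i+1); positivity
  have hle : ∀ i, Zt k₀ lam n v (i+2) ≤ lam / lam ^ n * S * ((1/2) * (h (i+1) + h (i+2))) := by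
    intro i
    have e1 : wk k₀ lam (i+2) = lam * wk k₀ lam (i+1) := by unfold wk; ring
    have e2 : wk k₀ lam (i+2+1) = lam * (lam * wk k₀ lam (i+1)) := by unfold wk; ring
    have e3 : i + 2 - 1 = i + 1 := by omega
    simp only [hh, Zt, e3]
    rw [show i + 1 + 1 = i + 2 from rfl, e1, e2]
    have hk := hw (i+1)
    have hSi := hS i
    set k := wk k₀ lam (i+1)
    set x := ‖v (i+1)‖
    set y := ‖v (i+2)‖ with hy
    set z := ‖v (i+2+1)‖ with hz
    have hy0 : 0 ≤ y := norm_nonneg _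
    have hz0 : 0 ≤ z := norm_nonneg _
    have : (lam * k)^(2*n+1) * (x * y * z)
        = lam / lam ^ n * (k * x) * (((lam * k)^n * y) * ((lam * (lam * k))^n * z)) := by
      rw [pow_succ, pow_mul', mul_pow lam (lam * k)]
      field_simp
    rw [this]
    have e : (lam * k)^(2*n) * y^2 + (lam * (lam * k))^(2*n) * z^2
      = ((lam * k)^n * y)^2 + ((lam * (lam * k))^n * z)^2 := by ring
    rw [e]
    refine mul_le_mul (by gcongr) ?_ (by positivity) (by positivity)
    nlinarith [sq_nonneg ((lam * k)^n * y - (lam * (lam * k))^n * z)]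
  have g1 := (summable_nat_add_iff 1).2 hH
  have g2 := (summable_nat_add_iff 2).2 hH
  have G := ((g1.add g2).mul_left (1/2)).mul_left (lam / lam ^ n * S)
  have hZ : Summable (fun i => Zt k₀ lam n v (i+2)) :=
    Summable.of_nonneg_of_le (fun i => by have := hw (i+2); unfold Zt; positivity) hle G
  refine ⟨hZ, (hZ.tsum_le_tsum hle G).trans ?_⟩
  rw [tsum_mul_left, tsum_mul_left, g1.tsum_add g2]
  have t1 := tail_le h hH hn 1
  have t2 := tail_le h hH hn 2
  have : HnS k₀ lam n v = ∑' i, h i := rfl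
  rw [this]
  gcongr
  linarith

theorem Z_bound2 {ν k₀ lam : ℝ} (hν : 0 < ν) (hk₀ : 0 < k₀) (hlam : 1 < lam) (a b : ℝ) (n : ℕ) (v : ℕ → ℂ) (S : ℝ)
    (hS : ∀ j, ‖v (j+1)‖^2 ≤ S)
    (hZ : Summable (fun i => Zt k₀ lam n v (i+2)))
    (hH : Summable (fun j : ℕ => (wk k₀ lam (j+1))^(2*n) * ‖v (j+1)‖^2))
    (hH1 : Summable (fun j : ℕ => (wk k₀ lam (j+1))^(2*(n+1)) * ‖v (j+1)‖^2)) :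
    Acoef a b lam n * (∑' i, Zt k₀ lam n v (i+2))
      ≤ ν/2 * HnS k₀ lam (n+1) v + dnS a b lam n / ν * S * HnS k₀ lam n v := by
  have hl0 : 0 < lam := by linarith
  have hw := fun i => wk_pos' hk₀ hlam i
  have hS0 : 0 ≤ S := le_trans (by positivity) (hS 0)
  set h : ℕ → ℝ := fun j : ℕ => (wk k₀ lam (j+1))^(2*n) * ‖v (j+1)‖^2 with hh
  set h' : ℕ → ℝ := fun j : ℕ => (wk k₀ lam (j+1))^(2*(n+1)) * ‖v (j+1)‖^2 with hh'
  have hn : ∀ i, 0 ≤ h i := fun i => by have := hw (i+1); positivity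
  have hn' : ∀ i, 0 ≤ h' i := fun i => by have := hw (i+1); positivity
  have hd0 : 0 ≤ dnS a b lam n := by unfold dnS; positivity
  have hA0 : 0 ≤ Acoef a b lam n := by unfold Acoef; positivity
  have hle : ∀ i, Acoef a b lam n * Zt k₀ lam n v (i+2) ≤
      ν/2 * h' (i+2) + dnS a b lam n / ν * S * h (i+1) := by
    intro i
    have e2 : wk k₀ lam (i+2+1) = lam * wk k₀ lam (i+2) := by unfold wk; ring
    have e3 : i + 2 - 1 = i + 1 := by omega
    simp only [hh, hh', Zt, e3]
    rw [show i + 1 + 1 = i + 2 from rfl, e2]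
    have hk := hw (i+2)
    have hSi := hS i
    set k := wk k₀ lam (i+2)
    set x := ‖v (i+1)‖ with hx
    set y := ‖v (i+2)‖ with hy
    set z := ‖v (i+2+1)‖ with hz
    set A := Acoef a b lam n with hA
    have e4 : A * (k^(2*n+1) * (x * y * z))
        = (cnS a b lam n / lam^2 * x * (k^n * y)) * ((lam * k)^(n+1) * z) := by
      rw [cnS_eq hlam, ← hA]
      rw [mul_pow lam k (n+1), pow_succ, pow_mul']
      field_simp
      ring
    have e5 : dnS a b lam n / ν * x^2 * (k^(2*n) * y^2)
        = (cnS a b lam n / lam^2 * x * (k^n * y))^2 / (2 * ν) := by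
      unfold dnS
      rw [pow_mul']
      field_simp
    have e6 : ν/2 * ((lam * k)^(2*(n+1)) * z^2) = ν/2 * ((lam * k)^(n+1) * z)^2 := by
      rw [pow_mul']; ring
    have e7 : dnS a b lam n / ν * x^2 * (k^(2*n) * y^2) ≤ dnS a b lam n / ν * S * (k^(2*n) * y^2) := by
      gcongr
    refine le_trans ?_ (add_le_add_right e7 _)
    rw [e4, e5, e6]
    generalize cnS a b lam n / lam^2 * x * (k^n * y) = P
    generalize (lam * k)^(n+1) * z = Q
    have : ν/2 * Q^2 + P^2/(2*ν) - P * Q = (ν * Q - P)^2 / (2*ν) := by field_simp; ring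
    have : 0 ≤ (ν * Q - P)^2 / (2*ν) := by positivity
    linarith
  have g1 := (summable_nat_add_iff 1).2 hH
  have g2 := (summable_nat_add_iff 2).2 hH1
  have G := (g2.mul_left (ν/2)).add (g1.mul_left (dnS a b lam n / ν * S))
  rw [← tsum_mul_left]
  refine ((hZ.mul_left _).tsum_le_tsum hle G).trans ?_
  rw [(g2.mul_left (ν/2)).tsum_add (g1.mul_left (dnS a b lam n / ν * S)), tsum_mul_left, tsum_mul_left]
  have t1 := tail_le h hH hn 1
  have t2 := tail_le h' hH1 hn' 2
  have r1 : HnS k₀ lam n v = ∑' i, h i := rfl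
  have r2 : HnS k₀ lam (n+1) v = ∑' i, h' i := rfl
  rw [r1, r2]
  gcongr

theorem Phi_le {k₀ lam : ℝ} (hk₀ : 0 < k₀) (hlam : 1 < lam) (n : ℕ) (f : ℕ → ℂ) (jmax : ℕ)
    (hcut : ∀ j : ℕ, jmax < j → f j = 0)
    (hΦ : Summable (fun j : ℕ => (wk k₀ lam (j+1))^(2*n) * ‖f (j+1)‖^2)) :
    PhinS k₀ lam (n+1) f ≤ (wk k₀ lam jmax)^2 * PhinS k₀ lam n f := by
  have hw := fun i => wk_pos' hk₀ hlam i
  have hle : ∀ j : ℕ, (wk k₀ lam (j+1))^(2*(n+1)) * ‖f (j+1)‖^2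
      ≤ (wk k₀ lam jmax)^2 * ((wk k₀ lam (j+1))^(2*n) * ‖f (j+1)‖^2) := by
    intro j
    by_cases h : jmax < j + 1
    · simp [hcut _ h]
    · have : wk k₀ lam (j+1) ≤ wk k₀ lam jmax := by
        unfold wk
        gcongr
        · exact hlam.le
        · omega
      have h1 := hw (j+1)
      calc (wk k₀ lam (j+1))^(2*(n+1)) * ‖f (j+1)‖^2
          = (wk k₀ lam (j+1))^2 * ((wk k₀ lam (j+1))^(2*n) * ‖f (j+1)‖^2) := by ring
        _ ≤ _ := by gcongr
  unfold PhinS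
  rw [← tsum_mul_left]
  exact (Summable.of_nonneg_of_le (fun j => by have := hw (j+1); positivity) hle
    (hΦ.mul_left _)).tsum_le_tsum hle (hΦ.mul_left _)

theorem HnS_nonneg {k₀ lam : ℝ} (hk₀ : 0 < k₀) (hlam : 1 < lam) (n : ℕ) (v : ℕ → ℂ) :
    0 ≤ HnS k₀ lam n v :=
  tsum_nonneg fun j => by have := wk_pos' hk₀ hlam (j+1); positivity

/-- if `H_n` vanishes (possibly as a junk value) then so does `H_{n+1}` -/
theorem HnS_succ_zero {k₀ lam : ℝ} (hk₀ : 0 < k₀) (hlam : 1 < lam) (n : ℕ) (v : ℕ → ℂ)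
    (h : HnS k₀ lam n v = 0) : HnS k₀ lam (n+1) v = 0 := by
  have hw := fun i => wk_pos' hk₀ hlam i
  by_cases hs : Summable (fun j : ℕ => (wk k₀ lam (j+1))^(2*n) * ‖v (j+1)‖^2)
  · have h1 := (hasSum_zero_iff_of_nonneg
      (f := fun j : ℕ => (wk k₀ lam (j+1))^(2*n) * ‖v (j+1)‖^2)
      (fun j => by have := hw (j+1); show (0:ℝ) ≤ _; positivity)).1
      (by have := hs.hasSum; rw [show ∑' j : ℕ, (wk k₀ lam (j+1))^(2*n) * ‖v (j+1)‖^2 = 0 from h] at this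
          exact this)
    have h2 : ∀ j, ‖v (j+1)‖^2 = 0 := by
      intro j
      have h3 := congrFun h1 j
      have := hw (j+1)
      simpa [this.ne'] using h3
    unfold HnS
    simp [h2]
  · unfold HnS
    refine tsum_eq_zero_of_not_summable fun hs1 => hs ?_
    refine Summable.of_nonneg_of_le (fun j => by have := hw (j+1); positivity) (fun j => ?_)
      (hs1.mul_left ((k₀^2)⁻¹))
    have hk : k₀ ≤ wk k₀ lam (j+1) := by
      unfold wk; exact le_mul_of_one_le_right hk₀.le (one_le_pow₀ hlam.le)
    have h1 := hw (j+1)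
    rw [← div_eq_inv_mul, le_div_iff₀ (by positivity)]
    calc _ ≤ (wk k₀ lam (j+1))^(2*n) * ‖v (j+1)‖^2 * (wk k₀ lam (j+1))^2 := by gcongr
      _ = _ := by ring

/-- the ladder inequalities for `K_n = H_n + τ² Φ_n`, `τ = ν⁻¹ k₀⁻²`, when the
forcing has a maximum wavenumber `k_max`. -/
theorem sabra_ladder_Kn (a b c ν k₀ lam : ℝ)
    (hν : 0 < ν) (hk₀ : 0 < k₀) (hlam : 1 < lam) (habc : a + b + c = 0)
    (n : ℕ) (f : ℕ → ℂ) (jmax : ℕ)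
    (hcut : ∀ j : ℕ, jmax < j → f j = 0)
    (hΦ : Summable (fun j : ℕ => (wk k₀ lam (j+1))^(2*n) * ‖f (j+1)‖^2))
    (u : ℕ → ℝ → ℂ)
    (hsol : IsSabraSolution a b c ν k₀ lam f u Set.univ)
    (t : ℝ) (D : ℝ)
    (hD : HasDerivAt
      (fun τ => HnS k₀ lam n (fun j => u j τ) + ((ν * k₀^2)⁻¹)^2 * PhinS k₀ lam n f) D t) :
    (1/2) * D ≤ -(ν * (HnS k₀ lam (n+1) (fun j => u j t)
          + ((ν * k₀^2)⁻¹)^2 * PhinS k₀ lam (n+1) f))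
        + cnS a b lam n
            * (HnS k₀ lam n (fun j => u j t) + ((ν * k₀^2)⁻¹)^2 * PhinS k₀ lam n f)
            * (⨆ j : ℕ, wk k₀ lam (j+1) * ‖u (j+1) t‖)
        + ν * (k₀^2 + (wk k₀ lam jmax)^2)
            * (HnS k₀ lam n (fun j => u j t) + ((ν * k₀^2)⁻¹)^2 * PhinS k₀ lam n f) ∧
    (1/2) * D ≤ -(ν/2 * (HnS k₀ lam (n+1) (fun j => u j t)
          + ((ν * k₀^2)⁻¹)^2 * PhinS k₀ lam (n+1) f))
        + (dnS a b lam n / ν)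
            * (HnS k₀ lam n (fun j => u j t) + ((ν * k₀^2)⁻¹)^2 * PhinS k₀ lam n f)
            * (⨆ j : ℕ, ‖u (j+1) t‖^2)
        + ν * (k₀^2 + (wk k₀ lam jmax)^2)
            * (HnS k₀ lam n (fun j => u j t) + ((ν * k₀^2)⁻¹)^2 * PhinS k₀ lam n f) := by
  have hl0 : 0 < lam := by linarith
  have hw := fun i => wk_pos' hk₀ hlam i
  have hA0 : 0 ≤ Acoef a b lam n := by unfold Acoef; positivity
  have hc0 : 0 ≤ cnS a b lam n := by rw [cnS_eq hlam]; positivity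
  have hd0 : 0 ≤ dnS a b lam n := by unfold dnS; positivity
  have hP0 : 0 ≤ PhinS k₀ lam n f := HnS_nonneg hk₀ hlam n f
  have hP1 : 0 ≤ PhinS k₀ lam (n+1) f := HnS_nonneg hk₀ hlam (n+1) f
  have hPhi := Phi_le hk₀ hlam n f jmax hcut hΦ
  have hH0 := HnS_nonneg hk₀ hlam n (fun j => u j t)
  have hS10 : 0 ≤ ⨆ j : ℕ, wk k₀ lam (j+1) * ‖u (j+1) t‖ :=
    Real.iSup_nonneg fun j => by have := hw (j+1); positivity
  have hS20 : 0 ≤ ⨆ j : ℕ, ‖u (j+1) t‖^2 := Real.iSup_nonneg fun j => by positivity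
  have hD' : HasDerivAt (fun s => HnS k₀ lam n (fun j => u j s)) D t := by
    have := hD.sub_const (((ν * k₀^2)⁻¹)^2 * PhinS k₀ lam n f)
    simpa using this
  have hτ : 0 < ((ν * k₀^2)⁻¹)^2 := by positivity
  set τ2 := ((ν * k₀^2)⁻¹)^2 with hτ2
  set S1 := ⨆ j : ℕ, wk k₀ lam (j+1) * ‖u (j+1) t‖ with hS1
  set S2 := ⨆ j : ℕ, ‖u (j+1) t‖^2 with hS2
  have hPhi' : ν * (τ2 * PhinS k₀ lam (n+1) f)
      ≤ ν * (wk k₀ lam jmax)^2 * (τ2 * PhinS k₀ lam n f) := by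
    calc ν * (τ2 * PhinS k₀ lam (n+1) f)
        ≤ ν * (τ2 * ((wk k₀ lam jmax)^2 * PhinS k₀ lam n f)) := by gcongr
      _ = _ := by ring
  have hτP0 : 0 ≤ τ2 * PhinS k₀ lam n f := by positivity
  have hτP1 : 0 ≤ ν * (τ2 * PhinS k₀ lam (n+1) f) := by positivity
  have hdν : 0 ≤ dnS a b lam n / ν := by positivity
  by_cases hz : HnS k₀ lam n (fun j => u j t) = 0
  · -- minimum case
    have hmin : IsLocalMin (fun s => HnS k₀ lam n (fun j => u j s)) t :=
      Filter.Eventually.of_forall fun s => by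
        simp only [hz]; exact HnS_nonneg hk₀ hlam n _
    have hD0 : D = 0 := hmin.hasDerivAt_eq_zero hD'
    rw [HnS_succ_zero hk₀ hlam n _ hz, hz, hD0]
    simp only [zero_add, mul_zero]
    have r1 : 0 ≤ cnS a b lam n * (τ2 * PhinS k₀ lam n f) * S1 := by positivity
    have r2 : 0 ≤ dnS a b lam n / ν * (τ2 * PhinS k₀ lam n f) * S2 := by positivity
    have r3 : 0 ≤ ν * k₀^2 * (τ2 * PhinS k₀ lam n f) := by positivity
    constructor <;> linarith
  · -- regular case
    have hpos : 0 < HnS k₀ lam n (fun j => u j t) := lt_of_le_of_ne hH0 (Ne.symm hz)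
    set M := HnS k₀ lam n (fun j => u j t) + 1 with hM
    have hev : ∀ᶠ s in 𝓝 t, 0 < HnS k₀ lam n (fun j => u j s) ∧
        HnS k₀ lam n (fun j => u j s) < M :=
      (hD'.continuousAt.eventually (lt_mem_nhds hpos)).and
        (hD'.continuousAt.eventually (gt_mem_nhds (by rw [hM]; linarith)))
    have hdec0 : DecayAt lam u t 0 := by
      obtain ⟨ε, hε, hball⟩ := Metric.eventually_nhds_iff.1 hev
      have hM0 : 0 < M := by rw [hM]; linarith
      refine ⟨Real.sqrt (M / k₀^(2*n)), ε/2, Real.sqrt_nonneg _, by positivity, ?_⟩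
      intro s hs j
      rw [Nat.mul_zero, pow_zero, mul_one]
      obtain ⟨h1, h2⟩ := hball (y := s) (by
        rw [Real.dist_eq, abs_lt]
        constructor <;> linarith [hs.1, hs.2])
      apply Real.le_sqrt_of_sq_le
      cases j with
      | zero => rw [hsol.1 s]; simp; positivity
      | succ i =>
        have hsum : Summable (fun j : ℕ => (wk k₀ lam (j+1))^(2*n) * ‖u (j+1) s‖^2) := by
          by_contra hns
          have : HnS k₀ lam n (fun j => u j s) = 0 := tsum_eq_zero_of_not_summable hns
          linarith
        have h3 := hsum.le_tsum i (fun j _ => by have := hw (j+1); positivity)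
        have h4 : (wk k₀ lam (i+1))^(2*n) * ‖u (i+1) s‖^2 ≤ M := h3.trans h2.le
        rw [le_div_iff₀ (by positivity)]
        have hk : k₀ ≤ wk k₀ lam (i+1) := by
          unfold wk; exact le_mul_of_one_le_right hk₀.le (one_le_pow₀ hlam.le)
        refine le_trans ?_ h4
        rw [mul_comm]
        gcongr
    have hdec := decay_all a b c ν k₀ lam hν hk₀ hlam f jmax hcut u hsol t hdec0
    obtain ⟨hTs, hTd⟩ := term_deriv a b c ν k₀ lam hν hk₀ hlam f jmax hcut u hsol t n (hdec (2*n+2))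
    have hDe := hD'.unique hTd
    set v : ℕ → ℂ := fun j => u j t with hv
    have hv0 : v 0 = 0 := hsol.1 t
    have hdv : ∀ p, ∃ C, ∀ j, ‖v j‖ * lam ^ (j * p) ≤ C := by
      intro p
      obtain ⟨C, δ, _, hδ, hb⟩ := hdec p
      exact ⟨C, hb t ⟨by linarith, by linarith⟩⟩
    obtain ⟨C1, hC1⟩ := hdv (n+1)
    obtain ⟨C2, hC2⟩ := hdv (n+1+1)
    obtain ⟨C3, hC3⟩ := hdv 1
    obtain ⟨C4, hC4⟩ := hdv 0
    have hH := summable_H_of_decay hk₀ hlam v n C1 hC1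
    have hH1 := summable_H_of_decay hk₀ hlam v (n+1) C2 hC2
    have hb1 : BddAbove (Set.range fun j : ℕ => wk k₀ lam (j+1) * ‖u (j+1) t‖) := by
      refine ⟨k₀ * C3, ?_⟩
      rintro _ ⟨j, rfl⟩
      have := hC3 (j+1)
      rw [mul_one] at this
      calc wk k₀ lam (j+1) * ‖u (j+1) t‖ = k₀ * (‖v (j+1)‖ * lam ^ (j+1)) := by
            simp only [wk, hv]; ring
        _ ≤ _ := by gcongr
    have hb2 : BddAbove (Set.range fun j : ℕ => ‖u (j+1) t‖^2) := by
      refine ⟨C4^2, ?_⟩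
      rintro _ ⟨j, rfl⟩
      have := hC4 (j+1)
      rw [Nat.mul_zero, pow_zero, mul_one] at this
      show ‖v (j+1)‖^2 ≤ _
      gcongr
    have hle1 : ∀ j, wk k₀ lam (j+1) * ‖v (j+1)‖ ≤ S1 := fun j => le_ciSup hb1 j
    have hle2 : ∀ j, ‖v (j+1)‖^2 ≤ S2 := fun j => le_ciSup hb2 j
    obtain ⟨hZ, hZ1⟩ := Z_bound1 hk₀ hlam n v S1 hle1 hH
    have hZ2 := Z_bound2 hν hk₀ hlam a b n v S2 hle2 hZ hH hH1
    have hTs' : Summable (fun i => (wk k₀ lam (i+1))^(2*n) *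
        inner ℝ (v (i+1)) (sabraRHS a b c ν k₀ lam f v (i+1))) := by
      refine (hTs.mul_left (1/2)).congr fun i => ?_
      simp only [hv]; ring
    have hhalf : (1/2) * D = ∑' i, (wk k₀ lam (i+1))^(2*n) *
        inner ℝ (v (i+1)) (sabraRHS a b c ν k₀ lam f v (i+1)) := by
      rw [hDe, ← tsum_mul_left]
      refine tsum_congr fun i => ?_
      simp only [hv]; ring
    have hmain := sum_le hν hk₀ hlam a b c habc n f v hv0 hTs' hZ hH hH1 hΦ
    rw [← hhalf, ← hτ2] at hmain
    have hZ1' : Acoef a b lam n * (∑' i, Zt k₀ lam n v (i+2)) ≤ cnS a b lam n * HnS k₀ lam n v * S1 := by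
      calc _ ≤ Acoef a b lam n * (lam / lam ^ n * S1 * HnS k₀ lam n v) := by gcongr
        _ = _ := by rw [cnS_eq hlam]; ring
    have r1 : 0 ≤ cnS a b lam n * (τ2 * PhinS k₀ lam n f) * S1 := by positivity
    have r2 : 0 ≤ dnS a b lam n / ν * (τ2 * PhinS k₀ lam n f) * S2 := by positivity
    have r4 : 0 ≤ ν * (wk k₀ lam jmax)^2 * HnS k₀ lam n v := by positivity
    constructor <;> linarith
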